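/- For every nondegenerate triangle K in ℝ², dim Σ(K) = 21, and the following 21 degrees of freedom are unisolvent on Σ(K): the three matrix values τ(v_i) at the vertices (9 values), the moments ∫_{e_i} (n_iᵀ τ n_i) q ds for q ∈ ℙ₁(e_i) on each edge (6 values), the means ∫_{e_i} t_iᵀ τ n_i ds on each edge (3 values), and the moments ∫_K τ : q dx for constant q ∈ 𝕊 (3 values). In particular, if τ ∈ Σ(K) and all of these functionals vanish at τ, then τ = 0. -/

import Mathlib

open MeasureTheory Matrix

noncomputable section

/-- Points of the plane ℝ². -/
abbrev V2 := Fin 2 → ℝ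

/-- 2×2 real matrices. -/
abbrev Mat2 := Matrix (Fin 2) (Fin 2) ℝ

/-- The Euclidean dot product on ℝ². -/
def dot2 (x y : V2) : ℝ := x 0 * y 0 + x 1 * y 1

/-- The Euclidean norm on ℝ². -/
def norm2 (x : V2) : ℝ := Real.sqrt (dot2 x x)

/-- Rotation by -90 degrees, used to produce a unit normal from a unit tangent. -/
def rot (x : V2) : V2 := ![x 1, -(x 0)]

/-- The closed triangle with vertices `v 0, v 1, v 2`. -/
def tri (v : Fin 3 → V2) : Set V2 := convexHull ℝ (Set.range v)

/-- `f` is (the function of) a real polynomial in two variables of total degree at most `k`. -/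
def PolyDeg (k : ℕ) (f : V2 → ℝ) : Prop :=
  ∃ p : MvPolynomial (Fin 2) ℝ, p.totalDegree ≤ k ∧ ∀ x : V2, f x = MvPolynomial.eval x p

/-- matrix-valued polynomial fields of degree at most `k`, i.e. ℙ_k(·;𝕄). -/
def IsPolyMat (k : ℕ) (τ : V2 → Mat2) : Prop := ∀ i j, PolyDeg k fun x => τ x i j

/-- vector-valued polynomial fields of degree at most `k`, i.e. ℙ_k(·;ℝ²). -/
def IsPolyVec (k : ℕ) (f : V2 → V2) : Prop := ∀ i, PolyDeg k fun x => f x i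

/-- `f` agrees on `[0,1]` with a univariate polynomial of degree at most `k`
(used for restrictions to an edge, in an affine parametrization of the edge). -/
def IsPoly1 (k : ℕ) (f : ℝ → ℝ) : Prop :=
  ∃ p : Polynomial ℝ, p.natDegree ≤ k ∧ ∀ s ∈ Set.Icc (0:ℝ) 1, f s = Polynomial.eval s p

/-- Partial derivative in the `a`-th coordinate direction. -/
def pd (f : V2 → ℝ) (a : Fin 2) : V2 → ℝ := fun x => fderiv ℝ f x (Pi.single a 1)

/-- Directional derivative of `f` in direction `w`. -/
def dirD (f : V2 → ℝ) (w : V2) (x : V2) : ℝ := fderiv ℝ f x w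

/-- Row-wise divergence of a matrix-valued field. -/
def divMat (τ : V2 → Mat2) : V2 → V2 := fun x i => ∑ j, pd (fun y => τ y i j) j x

/-- The edge `e i` of the triangle, opposite to the vertex `v i`. -/
def edgeSet (v : Fin 3 → V2) (i : Fin 3) : Set V2 := segment ℝ (v (i+1)) (v (i+2))

/-- Affine parametrization of the edge `e i` over `[0,1]`. -/
def edgePt (v : Fin 3 → V2) (i : Fin 3) (s : ℝ) : V2 := v (i+1) + s • (v (i+2) - v (i+1))

/-- The length of the edge `e i`. -/
def elen (v : Fin 3 → V2) (i : Fin 3) : ℝ := norm2 (v (i+2) - v (i+1))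

/-- The unit tangent vector of the edge `e i`. -/
def tang (v : Fin 3 → V2) (i : Fin 3) : V2 := (elen v i)⁻¹ • (v (i+2) - v (i+1))

/-- The unit normal vector of the edge `e i`. -/
def nrml (v : Fin 3 → V2) (i : Fin 3) : V2 := rot (tang v i)

/-- The arclength integral over the edge `e i`. -/
def edgeInt (v : Fin 3 → V2) (i : Fin 3) (f : V2 → ℝ) : ℝ :=
  ∫ s in (0:ℝ)..1, f (edgePt v i s) * elen v i

/-- The symmetric part of a matrix. -/
def symm2 (A : Mat2) : Mat2 := (2:ℝ)⁻¹ • (A + Aᵀ)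

/-- The shape function space Σ(K) = {τ ∈ ℙ₃(K;𝕊) : div τ ∈ ℙ₁(K;ℝ²),
tᵀτn|ₑ ∈ ℙ₂(e) for each edge e}. -/
def SigmaSet (v : Fin 3 → V2) : Set (V2 → Mat2) :=
  {τ | IsPolyMat 3 τ ∧ (∀ x, (τ x).IsSymm) ∧ IsPolyVec 1 (divMat τ) ∧
    ∀ i : Fin 3, IsPoly1 2 fun s => dot2 (tang v i) ((τ (edgePt v i s)).mulVec (nrml v i))}

/-- Normal-normal edge moment DoF: ∫_{e_i} (nᵀ τ n) q ds (arclength), with the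
weight q ∈ ℙ₁(e_i) given in the affine parametrization of the edge. -/
def dofNN (v : Fin 3 → V2) (i : Fin 3) (τ : V2 → Mat2) (P : Polynomial ℝ) : ℝ :=
  ∫ s in (0:ℝ)..1,
    dot2 (nrml v i) ((τ (edgePt v i s)).mulVec (nrml v i)) * Polynomial.eval s P * elen v i

/-- Tangent-normal edge mean DoF: ∫_{e_i} tᵀ τ n ds (arclength). -/
def dofTN (v : Fin 3 → V2) (i : Fin 3) (τ : V2 → Mat2) : ℝ :=
  ∫ s in (0:ℝ)..1, dot2 (tang v i) ((τ (edgePt v i s)).mulVec (nrml v i)) * elen v i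

/-- Interior moment DoF: ∫_K τ : q dx, Frobenius inner product against a constant matrix. -/
def dofInt (v : Fin 3 → V2) (τ : V2 → Mat2) (q : Mat2) : ℝ :=
  ∫ x in tri v, ∑ i, ∑ j, τ x i j * q i j

namespace PolyDeg

lemma mono {k l : ℕ} (h : k ≤ l) {f : V2 → ℝ} (hf : PolyDeg k f) : PolyDeg l f := by
  obtain ⟨p, hp, hf⟩ := hf
  exact ⟨p, hp.trans h, hf⟩

lemma add {k : ℕ} {f g : V2 → ℝ} (hf : PolyDeg k f) (hg : PolyDeg k g) :
    PolyDeg k (fun x => f x + g x) := by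
  obtain ⟨p, hp, hf⟩ := hf
  obtain ⟨q, hq, hg⟩ := hg
  exact ⟨p + q, (MvPolynomial.totalDegree_add p q).trans (max_le hp hq), fun x => by
    simp [hf, hg]⟩

lemma const (k : ℕ) (c : ℝ) : PolyDeg k (fun _ => c) :=
  ⟨MvPolynomial.C c, by simp, fun x => by simp⟩

lemma mul {k l : ℕ} {f g : V2 → ℝ} (hf : PolyDeg k f) (hg : PolyDeg l g) :
    PolyDeg (k + l) (fun x => f x * g x) := by
  obtain ⟨p, hp, hf⟩ := hf
  obtain ⟨q, hq, hg⟩ := hg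
  exact ⟨p * q, (MvPolynomial.totalDegree_mul p q).trans (add_le_add hp hq), fun x => by
    simp [hf, hg]⟩

lemma const_mul {k : ℕ} (c : ℝ) {f : V2 → ℝ} (hf : PolyDeg k f) :
    PolyDeg k (fun x => c * f x) := by
  simpa using (const 0 c).mul hf

lemma pow {k : ℕ} {f : V2 → ℝ} (hf : PolyDeg k f) (n : ℕ) :
    PolyDeg (n * k) (fun x => f x ^ n) := by
  obtain ⟨p, hp, hf⟩ := hf
  exact ⟨p ^ n, (MvPolynomial.totalDegree_pow p n).trans (Nat.mul_le_mul_left n hp), fun x => by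
    simp [hf]⟩

lemma sum {ι : Type*} {k : ℕ} (s : Finset ι) {f : ι → V2 → ℝ}
    (hf : ∀ i ∈ s, PolyDeg k (f i)) : PolyDeg k (fun x => ∑ i ∈ s, f i x) := by
  choose! p hp hf using hf
  refine ⟨∑ i ∈ s, p i, MvPolynomial.totalDegree_finsetSum_le hp, fun x => ?_⟩
  rw [map_sum]
  exact Finset.sum_congr rfl fun i hi => hf i hi x

lemma coord (j : Fin 2) : PolyDeg 1 (fun x => x j) :=
  ⟨MvPolynomial.X j, by simp, fun x => by simp⟩

lemma affine (c₀ c₁ c₂ : ℝ) : PolyDeg 1 (fun x => c₀ + c₁ * x 0 + c₂ * x 1) :=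
  ((const 1 c₀).add ((coord 0).const_mul c₁)).add ((coord 1).const_mul c₂)

/-- The monomial expansion of a polynomial function. -/
lemma exists_expansion {k : ℕ} {f : V2 → ℝ} (hf : PolyDeg k f) :
    ∃ (s : Finset (Fin 2 →₀ ℕ)) (c : (Fin 2 →₀ ℕ) → ℝ), (∀ d ∈ s, d 0 + d 1 ≤ k) ∧
      ∀ x, f x = ∑ d ∈ s, c d * (x 0 ^ d 0 * x 1 ^ d 1) := by
  obtain ⟨p, hp, hf⟩ := hf
  refine ⟨p.support, fun d => p.coeff d, fun d hd => ?_, fun x => ?_⟩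
  · have := (MvPolynomial.le_totalDegree hd).trans hp
    rwa [Finsupp.sum_fintype _ _ (by simp), Fin.sum_univ_two] at this
  · rw [hf, MvPolynomial.eval_eq']
    simp [Fin.prod_univ_two]

lemma comp {k : ℕ} {f : V2 → ℝ} (hf : PolyDeg k f) {A : V2 → V2}
    (hA : ∀ j, PolyDeg 1 fun x => A x j) : PolyDeg k (fun x => f (A x)) := by
  obtain ⟨s, c, hs, h⟩ := hf.exists_expansion
  simp only [h]
  refine sum s fun d hd => const_mul _ (mono ?_ (((hA 0).pow (d 0)).mul ((hA 1).pow (d 1))))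
  simpa using hs d hd

end PolyDeg

/-- The cubic polynomial with coefficients `c` in the graded monomial basis. -/
def cubic (c : Fin 10 → ℝ) (s t : ℝ) : ℝ :=
  c 0 + c 1 * s + c 2 * t + c 3 * s ^ 2 + c 4 * (s * t) + c 5 * t ^ 2 + c 6 * s ^ 3 +
    c 7 * (s ^ 2 * t) + c 8 * (s * t ^ 2) + c 9 * t ^ 3

lemma PolyDeg.exists_cubic {f : V2 → ℝ} (hf : PolyDeg 3 f) :
    ∃ c, ∀ x, f x = cubic c (x 0) (x 1) := by
  obtain ⟨s, c, hs, h⟩ := hf.exists_expansion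
  have key : ∀ d ∈ s, ∃ e, ∀ x : V2, c d * (x 0 ^ d 0 * x 1 ^ d 1) = cubic e (x 0) (x 1) := by
    intro d hd
    have hd' := hs d hd
    generalize c d = r
    generalize d 0 = m at *
    generalize d 1 = n at *
    have hm : m ≤ 3 := by omega
    interval_cases m
    · have hn : n ≤ 3 := by omega
      interval_cases n
      · exact ⟨Pi.single 0 r, fun x => by simp [cubic]⟩
      · exact ⟨Pi.single 2 r, fun x => by simp [cubic]⟩
      · exact ⟨Pi.single 5 r, fun x => by simp [cubic]⟩
      · exact ⟨Pi.single 9 r, fun x => by simp [cubic]⟩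
    · have hn : n ≤ 2 := by omega
      interval_cases n
      · exact ⟨Pi.single 1 r, fun x => by simp [cubic]⟩
      · exact ⟨Pi.single 4 r, fun x => by simp [cubic]⟩
      · exact ⟨Pi.single 8 r, fun x => by simp [cubic]⟩
    · have hn : n ≤ 1 := by omega
      interval_cases n
      · exact ⟨Pi.single 3 r, fun x => by simp [cubic]⟩
      · exact ⟨Pi.single 7 r, fun x => by simp [cubic]⟩
    · obtain rfl : n = 0 := by omega
      exact ⟨Pi.single 6 r, fun x => by simp [cubic]⟩
  choose! e he using key
  refine ⟨∑ d ∈ s, e d, fun x => ?_⟩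
  rw [h, Finset.sum_congr rfl fun d hd => he d hd x]
  simp only [cubic, Finset.sum_apply, Finset.sum_mul, Finset.sum_add_distrib]

lemma PolyDeg.exists_affine {f : V2 → ℝ} (hf : PolyDeg 1 f) :
    ∃ c₀ c₁ c₂ : ℝ, ∀ x, f x = c₀ + c₁ * x 0 + c₂ * x 1 := by
  obtain ⟨s, c, hs, h⟩ := hf.exists_expansion
  have key : ∀ d ∈ s, ∃ e : Fin 3 → ℝ, ∀ x : V2,
      c d * (x 0 ^ d 0 * x 1 ^ d 1) = e 0 + e 1 * x 0 + e 2 * x 1 := by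
    intro d hd
    have hd' := hs d hd
    generalize c d = r
    generalize d 0 = m at *
    generalize d 1 = n at *
    obtain ⟨rfl, rfl⟩ | ⟨rfl, rfl⟩ | ⟨rfl, rfl⟩ :
      m = 0 ∧ n = 0 ∨ m = 1 ∧ n = 0 ∨ m = 0 ∧ n = 1 := by omega
    · exact ⟨Pi.single 0 r, fun x => by simp⟩
    · exact ⟨Pi.single 1 r, fun x => by simp⟩
    · exact ⟨Pi.single 2 r, fun x => by simp⟩
  choose! e he using key
  refine ⟨∑ d ∈ s, e d 0, ∑ d ∈ s, e d 1, ∑ d ∈ s, e d 2, fun x => ?_⟩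
  rw [h, Finset.sum_congr rfl fun d hd => he d hd x]
  simp only [Finset.sum_mul, Finset.sum_add_distrib]

/-- A polynomial function of degree at most three is a univariate cubic on every line. -/
lemma PolyDeg.exists_cubic_line {f : V2 → ℝ} (hf : PolyDeg 3 f) (p d : V2) :
    ∃ c₀ c₁ c₂ c₃ : ℝ, ∀ r : ℝ, f (p + r • d) = c₀ + c₁ * r + c₂ * r ^ 2 + c₃ * r ^ 3 := by
  have hA : PolyDeg 3 (fun x : V2 => f (p + x 0 • d)) := by
    refine hf.comp fun j => ?_
    have := PolyDeg.affine (p j) (d j) 0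
    simpa [mul_comm] using this
  obtain ⟨c, hc⟩ := hA.exists_cubic
  refine ⟨c 0, c 1, c 3, c 6, fun r => ?_⟩
  simpa [cubic] using hc ![r, 0]

lemma polyDeg_cubic (c : Fin 10 → ℝ) {s t : V2 → ℝ} (hs : PolyDeg 1 s) (ht : PolyDeg 1 t) :
    PolyDeg 3 (fun x => cubic c (s x) (t x)) := by
  have hst : PolyDeg 2 (fun x => s x * t x) := hs.mul ht
  have h {k : ℕ} (hk : k ≤ 3) (r : ℝ) {f : V2 → ℝ} (hf : PolyDeg k f) :
      PolyDeg 3 (fun x => r * f x) := (hf.const_mul r).mono hk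
  exact (((((((((PolyDeg.const 3 (c 0)).add (h (by norm_num) _ hs)).add
    (h (by norm_num) _ ht)).add (h (by norm_num) _ (hs.pow 2))).add
    (h (by norm_num) _ hst)).add (h (by norm_num) _ (ht.pow 2))).add
    (h (by norm_num) _ (hs.pow 3))).add (h (by norm_num) _ ((hs.pow 2).mul ht))).add
    (h (by norm_num) _ (hs.mul (ht.pow 2)))).add (h (by norm_num) _ (ht.pow 3))

/-- A cubic on the line restricts to a quadratic exactly when its third difference vanishes. -/
lemma isPoly1_two_iff {f : ℝ → ℝ} {c₀ c₁ c₂ c₃ : ℝ}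
    (hf : ∀ r, f r = c₀ + c₁ * r + c₂ * r ^ 2 + c₃ * r ^ 3) :
    IsPoly1 2 f ↔ f 3 - 3 * f 2 + 3 * f 1 - f 0 = 0 := by
  constructor
  · rintro ⟨p, hp, h⟩
    have hev (r : ℝ) : p.eval r = p.coeff 0 + p.coeff 1 * r + p.coeff 2 * r ^ 2 := by
      rw [Polynomial.eval_eq_sum_range' (Nat.lt_succ_of_le hp)]
      simp [Finset.sum_range_succ]
    have h0 := h 0 (by norm_num)
    have h1 := h (1 / 3) (by norm_num)
    have h2 := h (2 / 3) (by norm_num)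
    have h3 := h 1 (by norm_num)
    simp only [hf, hev] at *
    linarith
  · intro h
    simp only [hf] at h
    have h3 : c₃ = 0 := by linarith
    refine ⟨Polynomial.C c₀ + Polynomial.C c₁ * Polynomial.X +
      Polynomial.C c₂ * Polynomial.X ^ 2, by compute_degree, fun r _ => ?_⟩
    simp [hf, h3]

/-- The planar cross product. -/
def cross2 (x y : V2) : ℝ := x 0 * y 1 - x 1 * y 0

/-- Twice the signed area of the triangle. -/
def area2 (v : Fin 3 → V2) : ℝ := cross2 (v 1 - v 0) (v 2 - v 0)

/-- The barycentric coordinate attached to the vertex `v 1`. -/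
def bary1 (v : Fin 3 → V2) (x : V2) : ℝ := cross2 (x - v 0) (v 2 - v 0) / area2 v

/-- The barycentric coordinate attached to the vertex `v 2`. -/
def bary2 (v : Fin 3 → V2) (x : V2) : ℝ := cross2 (v 1 - v 0) (x - v 0) / area2 v

lemma area2_ne_zero {v : Fin 3 → V2} (hv : AffineIndependent ℝ v) : area2 v ≠ 0 := by
  intro h0
  rw [affineIndependent_iff] at hv
  simp only [area2, cross2, Pi.sub_apply] at h0
  have key (c₁ c₂ : ℝ) (h : ∀ j, c₁ * (v 1 j - v 0 j) + c₂ * (v 2 j - v 0 j) = 0) :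
      c₁ = 0 ∧ c₂ = 0 := by
    have := hv Finset.univ ![-c₁ - c₂, c₁, c₂] (by
      simp [Fin.sum_univ_three]
      ring) (by
      ext j
      simp only [Fin.sum_univ_three, Pi.add_apply, Pi.smul_apply, smul_eq_mul]
      simp
      linarith [h j])
    exact ⟨by simpa using this 1, by simpa using this 2⟩
  have e0 := key (v 2 0 - v 0 0) (-(v 1 0 - v 0 0)) (by
    intro j
    fin_cases j <;> simp <;> linarith)
  have e1 := key (v 2 1 - v 0 1) (-(v 1 1 - v 0 1)) (by
    intro j
    fin_cases j <;> simp <;> linarith)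
  have := key 1 0 (by
    intro j
    fin_cases j <;> simp <;> linarith [e0.2, e1.2])
  exact one_ne_zero this.1

/-- The edge vectors at `v 0` are linearly independent. -/
lemma eq_zero_of_edge_comb {v : Fin 3 → V2} (hD : area2 v ≠ 0) {X Y : ℝ}
    (h : ∀ j, (v 1 j - v 0 j) * X + (v 2 j - v 0 j) * Y = 0) : X = 0 ∧ Y = 0 := by
  have h0 := h 0
  have h1 := h 1
  constructor <;> refine (mul_eq_zero.mp ?_).resolve_left hD <;>
    simp only [area2, cross2, Pi.sub_apply]
  · linear_combination (v 2 1 - v 0 1) * h0 - (v 2 0 - v 0 0) * h1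
  · linear_combination (v 1 0 - v 0 0) * h1 - (v 1 1 - v 0 1) * h0

lemma bary1_add (v : Fin 3 → V2) (x d : V2) (r : ℝ) :
    bary1 v (x + r • d) = bary1 v x + r * (cross2 d (v 2 - v 0) / area2 v) := by
  simp [bary1, cross2]
  ring

lemma bary2_add (v : Fin 3 → V2) (x d : V2) (r : ℝ) :
    bary2 v (x + r • d) = bary2 v x + r * (cross2 (v 1 - v 0) d / area2 v) := by
  simp [bary2, cross2]
  ring

lemma bary1_comb {v : Fin 3 → V2} (hD : area2 v ≠ 0) (m n : ℝ) :
    bary1 v (v 0 + m • (v 1 - v 0) + n • (v 2 - v 0)) = m := by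
  rw [bary1, div_eq_iff hD]
  simp [area2, cross2]
  ring

lemma bary2_comb {v : Fin 3 → V2} (hD : area2 v ≠ 0) (m n : ℝ) :
    bary2 v (v 0 + m • (v 1 - v 0) + n • (v 2 - v 0)) = n := by
  rw [bary2, div_eq_iff hD]
  simp [area2, cross2]
  ring

lemma eq_bary_comb {v : Fin 3 → V2} (hD : area2 v ≠ 0) (x : V2) :
    x = v 0 + bary1 v x • (v 1 - v 0) + bary2 v x • (v 2 - v 0) := by
  ext j
  simp only [bary1, bary2, Pi.add_apply, Pi.smul_apply, Pi.sub_apply, smul_eq_mul]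
  field_simp
  fin_cases j <;> simp [area2, cross2] <;> ring

lemma polyDeg_bary1 (v : Fin 3 → V2) : PolyDeg 1 (bary1 v) := by
  obtain ⟨p, hp, h⟩ := PolyDeg.affine (cross2 (-v 0) (v 2 - v 0) / area2 v)
    ((v 2 1 - v 0 1) / area2 v) (-(v 2 0 - v 0 0) / area2 v)
  refine ⟨p, hp, fun x => ?_⟩
  rw [← h]
  simp [bary1, cross2]
  ring

lemma polyDeg_bary2 (v : Fin 3 → V2) : PolyDeg 1 (bary2 v) := by
  obtain ⟨p, hp, h⟩ := PolyDeg.affine (cross2 (v 1 - v 0) (-v 0) / area2 v)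
    (-(v 1 1 - v 0 1) / area2 v) ((v 1 0 - v 0 0) / area2 v)
  refine ⟨p, hp, fun x => ?_⟩
  rw [← h]
  simp [bary2, cross2]
  ring

lemma PolyDeg.continuous {k : ℕ} {f : V2 → ℝ} (hf : PolyDeg k f) : Continuous f := by
  obtain ⟨p, -, h⟩ := hf
  rw [show f = fun x => MvPolynomial.eval x p from funext h]
  exact MvPolynomial.continuous_eval p

lemma PolyDeg.differentiable {k : ℕ} {f : V2 → ℝ} (hf : PolyDeg k f) : Differentiable ℝ f := by
  obtain ⟨s, c, -, h⟩ := hf.exists_expansion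
  rw [funext h]
  fun_prop

/-- A cubic polynomial in barycentric coordinates. -/
def baryCubic (v : Fin 3 → V2) (c : Fin 10 → ℝ) (x : V2) : ℝ := cubic c (bary1 v x) (bary2 v x)

lemma polyDeg_baryCubic (v : Fin 3 → V2) (c : Fin 10 → ℝ) : PolyDeg 3 (baryCubic v c) :=
  polyDeg_cubic c (polyDeg_bary1 v) (polyDeg_bary2 v)

lemma PolyDeg.exists_baryCubic {v : Fin 3 → V2} (hD : area2 v ≠ 0) {f : V2 → ℝ}
    (hf : PolyDeg 3 f) : ∃ c, f = baryCubic v c := by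
  have hA : PolyDeg 3 (fun y : V2 => f (v 0 + y 0 • (v 1 - v 0) + y 1 • (v 2 - v 0))) := by
    refine hf.comp fun j => ?_
    have := PolyDeg.affine (v 0 j) (v 1 j - v 0 j) (v 2 j - v 0 j)
    simpa [mul_comm] using this
  obtain ⟨c, hc⟩ := hA.exists_cubic
  refine ⟨c, funext fun x => ?_⟩
  have := hc ![bary1 v x, bary2 v x]
  simp only [Matrix.cons_val_zero, Matrix.cons_val_one] at this
  rw [baryCubic, ← this, ← eq_bary_comb hD]

lemma baryCubic_add (v : Fin 3 → V2) (c d : Fin 10 → ℝ) (x : V2) :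
    baryCubic v (c + d) x = baryCubic v c x + baryCubic v d x := by
  simp [baryCubic, cubic]
  ring

lemma baryCubic_smul (v : Fin 3 → V2) (r : ℝ) (c : Fin 10 → ℝ) (x : V2) :
    baryCubic v (r • c) x = r * baryCubic v c x := by
  simp [baryCubic, cubic]
  ring

/-- The derivative of `cubic c` with respect to its first variable. -/
def cubicDs (c : Fin 10 → ℝ) (s t : ℝ) : ℝ :=
  c 1 + 2 * c 3 * s + c 4 * t + 3 * c 6 * s ^ 2 + 2 * c 7 * (s * t) + c 8 * t ^ 2

/-- The derivative of `cubic c` with respect to its second variable. -/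
def cubicDt (c : Fin 10 → ℝ) (s t : ℝ) : ℝ :=
  c 2 + c 4 * s + 2 * c 5 * t + c 7 * s ^ 2 + 2 * c 8 * (s * t) + 3 * c 9 * t ^ 2

lemma fderiv_baryCubic (v : Fin 3 → V2) (c : Fin 10 → ℝ) (x d : V2) :
    fderiv ℝ (baryCubic v c) x d =
      cubicDs c (bary1 v x) (bary2 v x) * (cross2 d (v 2 - v 0) / area2 v) +
      cubicDt c (bary1 v x) (bary2 v x) * (cross2 (v 1 - v 0) d / area2 v) := by
  rw [← ((polyDeg_baryCubic v c).differentiable x).lineDeriv_eq_fderiv, lineDeriv]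
  simp only [baryCubic, bary1_add, bary2_add]
  generalize bary1 v x = s
  generalize bary2 v x = t
  generalize cross2 d (v 2 - v 0) / area2 v = p
  generalize cross2 (v 1 - v 0) d / area2 v = q
  have hs : HasDerivAt (fun r : ℝ => s + r * p) p 0 := by
    simpa using ((hasDerivAt_id (0 : ℝ)).mul_const p).const_add s
  have ht : HasDerivAt (fun r : ℝ => t + r * q) q 0 := by
    simpa using ((hasDerivAt_id (0 : ℝ)).mul_const q).const_add t
  have H := ((((((((((hs.const_mul (c 1)).const_add (c 0)).add (ht.const_mul (c 2))).add
    ((hs.pow 2).const_mul (c 3))).add ((hs.mul ht).const_mul (c 4))).add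
    ((ht.pow 2).const_mul (c 5))).add ((hs.pow 3).const_mul (c 6))).add
    (((hs.pow 2).mul ht).const_mul (c 7))).add ((hs.mul (ht.pow 2)).const_mul (c 8))).add
    ((ht.pow 3).const_mul (c 9)))
  refine (HasDerivAt.deriv (f := fun r => cubic c (s + r * p) (t + r * q)) H).trans ?_
  simp [cubicDs, cubicDt]
  ring

/-- The symmetric matrix field `P aaᵀ + Q (abᵀ + baᵀ) + R bbᵀ`, where `a`, `b` are the edge
vectors at `v 0` and `P`, `Q`, `R` are the cubics with coefficients `w 0`, `w 1`, `w 2`. -/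
def fieldOf (v : Fin 3 → V2) : (Fin 3 → Fin 10 → ℝ) →ₗ[ℝ] (V2 → Mat2) where
  toFun w x := .of fun i j =>
    baryCubic v (w 0) x * ((v 1 i - v 0 i) * (v 1 j - v 0 j)) +
    baryCubic v (w 1) x *
      ((v 1 i - v 0 i) * (v 2 j - v 0 j) + (v 2 i - v 0 i) * (v 1 j - v 0 j)) +
    baryCubic v (w 2) x * ((v 2 i - v 0 i) * (v 2 j - v 0 j))
  map_add' w w' := by
    ext x i j
    simp [baryCubic_add]
    ring
  map_smul' r w := by
    ext x i j
    simp [baryCubic_smul]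
    ring

lemma fieldOf_apply (v : Fin 3 → V2) (w : Fin 3 → Fin 10 → ℝ) (x : V2) (i j : Fin 2) :
    fieldOf v w x i j = baryCubic v (w 0) x * ((v 1 i - v 0 i) * (v 1 j - v 0 j)) +
      baryCubic v (w 1) x *
        ((v 1 i - v 0 i) * (v 2 j - v 0 j) + (v 2 i - v 0 i) * (v 1 j - v 0 j)) +
      baryCubic v (w 2) x * ((v 2 i - v 0 i) * (v 2 j - v 0 j)) := rfl

lemma fieldOf_isSymm (v : Fin 3 → V2) (w : Fin 3 → Fin 10 → ℝ) (x : V2) :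
    (fieldOf v w x).IsSymm := by
  ext i j
  simp only [Matrix.transpose_apply, fieldOf_apply]
  ring

lemma polyDeg_fieldOf (v : Fin 3 → V2) (w : Fin 3 → Fin 10 → ℝ) : IsPolyMat 3 (fieldOf v w) := by
  intro i j
  have := (((polyDeg_baryCubic v (w 0)).const_mul ((v 1 i - v 0 i) * (v 1 j - v 0 j))).add
    ((polyDeg_baryCubic v (w 1)).const_mul
      ((v 1 i - v 0 i) * (v 2 j - v 0 j) + (v 2 i - v 0 i) * (v 1 j - v 0 j)))).add
    ((polyDeg_baryCubic v (w 2)).const_mul ((v 2 i - v 0 i) * (v 2 j - v 0 j)))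
  simpa only [fieldOf_apply, mul_comm] using this

/-- Every symmetric cubic matrix field is of the form `fieldOf v w`. -/
lemma exists_fieldOf {v : Fin 3 → V2} (hD : area2 v ≠ 0) {τ : V2 → Mat2} (hτ : IsPolyMat 3 τ)
    (hs : ∀ x, (τ x).IsSymm) : ∃ w, τ = fieldOf v w := by
  choose c hc using fun i j => (hτ i j).exists_baryCubic hD
  replace hc (i j : Fin 2) (x : V2) : τ x i j = baryCubic v (c i j) x := congrFun (hc i j) x
  set a := v 1 - v 0 with ha
  set b := v 2 - v 0 with hb
  refine ⟨![((area2 v) ^ 2)⁻¹ • (b 1 ^ 2 • c 0 0 + (-2 * b 0 * b 1) • c 0 1 + b 0 ^ 2 • c 1 1),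
    ((area2 v) ^ 2)⁻¹ • ((-a 1 * b 1) • c 0 0 + (a 0 * b 1 + a 1 * b 0) • c 0 1 +
      (-a 0 * b 0) • c 1 1),
    ((area2 v) ^ 2)⁻¹ • (a 1 ^ 2 • c 0 0 + (-2 * a 0 * a 1) • c 0 1 + a 0 ^ 2 • c 1 1)], ?_⟩
  ext x i j
  have h10 : τ x 1 0 = τ x 0 1 := (hs x).apply 0 1
  simp only [fieldOf_apply, Matrix.cons_val, baryCubic_smul, baryCubic_add, ← hc, ← Pi.sub_apply,
    ← ha, ← hb]
  have hD' : a 0 * b 1 - a 1 * b 0 ≠ 0 := hD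
  rw [area2, ← ha, ← hb, cross2]
  field_simp
  fin_cases i <;> fin_cases j <;> simp [h10] <;> ring

lemma divMat_fieldOf {v : Fin 3 → V2} (hD : area2 v ≠ 0) (w : Fin 3 → Fin 10 → ℝ) (x : V2)
    (i : Fin 2) :
    divMat (fieldOf v w) x i =
      (v 1 i - v 0 i) * (cubicDs (w 0) (bary1 v x) (bary2 v x) +
        cubicDt (w 1) (bary1 v x) (bary2 v x)) +
      (v 2 i - v 0 i) * (cubicDs (w 1) (bary1 v x) (bary2 v x) +
        cubicDt (w 2) (bary1 v x) (bary2 v x)) := by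
  have h (c : Fin 10 → ℝ) := (polyDeg_baryCubic v c).differentiable x
  have hpd (j : Fin 2) : pd (fun y => fieldOf v w y i j) j x =
      fderiv ℝ (baryCubic v (w 0)) x (Pi.single j 1) * ((v 1 i - v 0 i) * (v 1 j - v 0 j)) +
      fderiv ℝ (baryCubic v (w 1)) x (Pi.single j 1) *
        ((v 1 i - v 0 i) * (v 2 j - v 0 j) + (v 2 i - v 0 i) * (v 1 j - v 0 j)) +
      fderiv ℝ (baryCubic v (w 2)) x (Pi.single j 1) * ((v 2 i - v 0 i) * (v 2 j - v 0 j)) := by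
    have H := (((h (w 0)).hasFDerivAt.mul_const ((v 1 i - v 0 i) * (v 1 j - v 0 j))).add
      ((h (w 1)).hasFDerivAt.mul_const
        ((v 1 i - v 0 i) * (v 2 j - v 0 j) + (v 2 i - v 0 i) * (v 1 j - v 0 j)))).add
      ((h (w 2)).hasFDerivAt.mul_const ((v 2 i - v 0 i) * (v 2 j - v 0 j)))
    rw [pd]
    refine (congrArg (fun L : V2 →L[ℝ] ℝ => L (Pi.single j 1)) (HasFDerivAt.fderiv
      (f := fun y => fieldOf v w y i j) H)).trans ?_
    simp
    ring
  have hD' : ((v 1 0 - v 0 0) * (v 2 1 - v 0 1) - (v 1 1 - v 0 1) * (v 2 0 - v 0 0)) *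
      (area2 v)⁻¹ = 1 := mul_inv_cancel₀ hD
  simp only [divMat, Fin.sum_univ_two, hpd, fderiv_baryCubic, cross2, Pi.sub_apply,
    Pi.single_apply, div_eq_mul_inv]
  generalize (area2 v)⁻¹ = e at hD' ⊢
  norm_num
  linear_combination ((v 1 i - v 0 i) * (cubicDs (w 0) (bary1 v x) (bary2 v x) +
    cubicDt (w 1) (bary1 v x) (bary2 v x)) + (v 2 i - v 0 i) *
    (cubicDs (w 1) (bary1 v x) (bary2 v x) + cubicDt (w 2) (bary1 v x) (bary2 v x))) * hD'

/-- The six linear conditions expressing that `divMat (fieldOf v w)` is affine. -/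
def divCoeff : (Fin 3 → Fin 10 → ℝ) →ₗ[ℝ] (Fin 6 → ℝ) where
  toFun w := ![3 * w 0 6 + w 1 7, w 0 7 + w 1 8, w 0 8 + 3 * w 1 9,
    3 * w 1 6 + w 2 7, w 1 7 + w 2 8, w 1 8 + 3 * w 2 9]
  map_add' w w' := by
    ext k
    fin_cases k <;> simp <;> ring
  map_smul' r w := by
    ext k
    fin_cases k <;> simp <;> ring

lemma divCoeff_eq_zero_iff (w : Fin 3 → Fin 10 → ℝ) :
    divCoeff w = 0 ↔ 3 * w 0 6 + w 1 7 = 0 ∧ w 0 7 + w 1 8 = 0 ∧ w 0 8 + 3 * w 1 9 = 0 ∧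
      3 * w 1 6 + w 2 7 = 0 ∧ w 1 7 + w 2 8 = 0 ∧ w 1 8 + 3 * w 2 9 = 0 := by
  simp [divCoeff, funext_iff, Fin.forall_fin_succ]

lemma isPolyVec_divMat_iff {v : Fin 3 → V2} (hD : area2 v ≠ 0) (w : Fin 3 → Fin 10 → ℝ) :
    IsPolyVec 1 (divMat (fieldOf v w)) ↔ divCoeff w = 0 := by
  rw [divCoeff_eq_zero_iff]
  constructor
  · intro h
    choose c₀ c₁ c₂ hc using fun i => (h i).exists_affine
    have hX (i : Fin 2) (m n : ℝ) := hc i (v 0 + m • (v 1 - v 0) + n • (v 2 - v 0))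
    simp only [divMat_fieldOf hD, bary1_comb hD, bary2_comb hD, Pi.add_apply, Pi.smul_apply,
      Pi.sub_apply, smul_eq_mul, cubicDs, cubicDt] at hX
    obtain ⟨h1, h4⟩ := eq_zero_of_edge_comb hD (X := 3 * w 0 6 + w 1 7) (Y := 3 * w 1 6 + w 2 7)
      fun i => by linarith [hX i 0 0, hX i 1 0, hX i 2 0]
    obtain ⟨h2, h5⟩ := eq_zero_of_edge_comb hD (X := w 0 7 + w 1 8) (Y := w 1 7 + w 2 8)
      fun i => by linarith [hX i 0 0, hX i 1 0, hX i 0 1, hX i 1 1]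
    obtain ⟨h3, h6⟩ := eq_zero_of_edge_comb hD (X := w 0 8 + 3 * w 1 9) (Y := w 1 8 + 3 * w 2 9)
      fun i => by linarith [hX i 0 0, hX i 0 1, hX i 0 2]
    exact ⟨h1, h2, h3, h4, h5, h6⟩
  · rintro ⟨h1, h2, h3, h4, h5, h6⟩ i
    obtain ⟨p, hp, hh⟩ := ((PolyDeg.const 1 ((v 1 i - v 0 i) * (w 0 1 + w 1 2) +
      (v 2 i - v 0 i) * (w 1 1 + w 2 2))).add ((polyDeg_bary1 v).const_mul
      ((v 1 i - v 0 i) * (2 * w 0 3 + w 1 4) + (v 2 i - v 0 i) * (2 * w 1 3 + w 2 4)))).add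
      ((polyDeg_bary2 v).const_mul
      ((v 1 i - v 0 i) * (w 0 4 + 2 * w 1 5) + (v 2 i - v 0 i) * (w 1 4 + 2 * w 2 5)))
    refine ⟨p, hp, fun x => ?_⟩
    rw [← hh]
    beta_reduce
    rw [divMat_fieldOf hD, cubicDs, cubicDs, cubicDt, cubicDt]
    generalize bary1 v x = s
    generalize bary2 v x = t
    linear_combination (v 1 i - v 0 i) * (s ^ 2 * h1 + 2 * s * t * h2 + t ^ 2 * h3) +
      (v 2 i - v 0 i) * (s ^ 2 * h4 + 2 * s * t * h5 + t ^ 2 * h6)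

lemma IsPolyMat.continuous {k : ℕ} {τ : V2 → Mat2} (hτ : IsPolyMat k τ) : Continuous τ :=
  continuous_matrix fun i j => (hτ i j).continuous

lemma continuous_fieldOf (v : Fin 3 → V2) (w : Fin 3 → Fin 10 → ℝ) : Continuous (fieldOf v w) :=
  (polyDeg_fieldOf v w).continuous

lemma dot2_mulVec (p q : V2) (M : Mat2) :
    dot2 p (M.mulVec q) = p 0 * (M 0 0 * q 0 + M 0 1 * q 1) + p 1 * (M 1 0 * q 0 + M 1 1 * q 1) := by
  simp [dot2, Matrix.mulVec, dotProduct, Fin.sum_univ_two]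

lemma continuous_dot2_edge {τ : V2 → Mat2} (hτ : Continuous τ) (v : Fin 3 → V2) (i : Fin 3)
    (p q : V2) : Continuous fun r => dot2 p ((τ (edgePt v i r)).mulVec q) := by
  simp only [dot2_mulVec, edgePt]
  fun_prop

lemma dot2_add_mulVec (p q : V2) (M N : Mat2) :
    dot2 p ((M + N).mulVec q) = dot2 p (M.mulVec q) + dot2 p (N.mulVec q) := by
  simp only [dot2_mulVec, Matrix.add_apply]
  ring

lemma dot2_smul_mulVec (p q : V2) (r : ℝ) (M : Mat2) :
    dot2 p ((r • M).mulVec q) = r * dot2 p (M.mulVec q) := by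
  simp only [dot2_mulVec, Matrix.smul_apply, smul_eq_mul]
  ring

lemma IsPolyMat.exists_cubic_edge {τ : V2 → Mat2} (hτ : IsPolyMat 3 τ) (v : Fin 3 → V2)
    (i : Fin 3) (p q : V2) : ∃ c₀ c₁ c₂ c₃ : ℝ, ∀ r : ℝ,
      dot2 p ((τ (edgePt v i r)).mulVec q) = c₀ + c₁ * r + c₂ * r ^ 2 + c₃ * r ^ 3 := by
  have h := (((hτ 0 0).const_mul (p 0 * q 0)).add ((hτ 0 1).const_mul (p 0 * q 1))).add
    (((hτ 1 0).const_mul (p 1 * q 0)).add ((hτ 1 1).const_mul (p 1 * q 1)))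
  obtain ⟨c₀, c₁, c₂, c₃, hc⟩ := h.exists_cubic_line (v (i + 1)) (v (i + 2) - v (i + 1))
  refine ⟨c₀, c₁, c₂, c₃, fun r => ?_⟩
  rw [← hc, dot2_mulVec, edgePt]
  ring

/-- The tangential-normal component along an edge. -/
def tnComp (v : Fin 3 → V2) (i : Fin 3) (τ : V2 → Mat2) (r : ℝ) : ℝ :=
  dot2 (tang v i) ((τ (edgePt v i r)).mulVec (nrml v i))

/-- The third differences of the tangential-normal components along the edges. -/
def tnDiff (v : Fin 3 → V2) : (Fin 3 → Fin 10 → ℝ) →ₗ[ℝ] (Fin 3 → ℝ) where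
  toFun w i := tnComp v i (fieldOf v w) 3 - 3 * tnComp v i (fieldOf v w) 2 +
    3 * tnComp v i (fieldOf v w) 1 - tnComp v i (fieldOf v w) 0
  map_add' w w' := by
    ext i
    simp only [tnComp, map_add, Pi.add_apply, dot2_add_mulVec]
    ring
  map_smul' r w := by
    ext i
    simp only [tnComp, map_smul, Pi.smul_apply, dot2_smul_mulVec, smul_eq_mul, RingHom.id_apply]
    ring

/-- The coefficient vectors of the fields in `SigmaSet v`. -/
def sigmaCoeff (v : Fin 3 → V2) : Submodule ℝ (Fin 3 → Fin 10 → ℝ) :=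
  LinearMap.ker (divCoeff.prod (tnDiff v))

lemma fieldOf_mem_iff {v : Fin 3 → V2} (hD : area2 v ≠ 0) (w : Fin 3 → Fin 10 → ℝ) :
    fieldOf v w ∈ SigmaSet v ↔ w ∈ sigmaCoeff v := by
  have key : (∀ i, IsPoly1 2 (tnComp v i (fieldOf v w))) ↔ tnDiff v w = 0 := by
    rw [funext_iff]
    refine forall_congr' fun i => ?_
    obtain ⟨c₀, c₁, c₂, c₃, hc⟩ :=
      (polyDeg_fieldOf v w).exists_cubic_edge v i (tang v i) (nrml v i)
    exact isPoly1_two_iff hc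
  have hiff : w ∈ sigmaCoeff v ↔ divCoeff w = 0 ∧ tnDiff v w = 0 := by
    simp [sigmaCoeff]
  rw [hiff, ← key, ← isPolyVec_divMat_iff hD]
  exact ⟨fun h => ⟨h.2.2.1, h.2.2.2⟩,
    fun h => ⟨polyDeg_fieldOf v w, fieldOf_isSymm v w, h.1, h.2⟩⟩

lemma exists_sigmaCoeff {v : Fin 3 → V2} (hD : area2 v ≠ 0) {τ : V2 → Mat2}
    (hτ : τ ∈ SigmaSet v) : ∃ w ∈ sigmaCoeff v, τ = fieldOf v w := by
  obtain ⟨w, rfl⟩ := exists_fieldOf hD hτ.1 hτ.2.1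
  exact ⟨w, (fieldOf_mem_iff hD w).1 hτ, rfl⟩

lemma finrank_sigmaCoeff_ge (v : Fin 3 → V2) : 21 ≤ Module.finrank ℝ (sigmaCoeff v) := by
  have h := LinearMap.finrank_range_add_finrank_ker (divCoeff.prod (tnDiff v))
  have h' := Submodule.finrank_le (LinearMap.range (divCoeff.prod (tnDiff v)))
  simp only [Module.finrank_prod, Module.finrank_pi_fintype, Module.finrank_self, Finset.sum_const,
    Finset.card_univ, Fintype.card_fin, smul_eq_mul] at h h'
  rw [sigmaCoeff]
  omega

lemma dofNN_add {τ σ : V2 → Mat2} (hτ : Continuous τ) (hσ : Continuous σ) (v : Fin 3 → V2)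
    (i : Fin 3) (P : Polynomial ℝ) : dofNN v i (τ + σ) P = dofNN v i τ P + dofNN v i σ P := by
  have h1 := continuous_dot2_edge hτ v i (nrml v i) (nrml v i)
  have h2 := continuous_dot2_edge hσ v i (nrml v i) (nrml v i)
  rw [dofNN, dofNN, dofNN, ← intervalIntegral.integral_add]
  · simp only [Pi.add_apply, dot2_add_mulVec, add_mul]
  · exact ((h1.mul P.continuous).mul continuous_const).intervalIntegrable _ _
  · exact ((h2.mul P.continuous).mul continuous_const).intervalIntegrable _ _

lemma dofNN_smul (r : ℝ) (τ : V2 → Mat2) (v : Fin 3 → V2) (i : Fin 3) (P : Polynomial ℝ) :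
    dofNN v i (r • τ) P = r * dofNN v i τ P := by
  rw [dofNN, dofNN, ← intervalIntegral.integral_const_mul]
  simp only [Pi.smul_apply, dot2_smul_mulVec, mul_assoc]

lemma dofTN_add {τ σ : V2 → Mat2} (hτ : Continuous τ) (hσ : Continuous σ) (v : Fin 3 → V2)
    (i : Fin 3) : dofTN v i (τ + σ) = dofTN v i τ + dofTN v i σ := by
  have h1 := continuous_dot2_edge hτ v i (tang v i) (nrml v i)
  have h2 := continuous_dot2_edge hσ v i (tang v i) (nrml v i)
  rw [dofTN, dofTN, dofTN, ← intervalIntegral.integral_add]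
  · simp only [Pi.add_apply, dot2_add_mulVec, add_mul]
  · exact (h1.mul continuous_const).intervalIntegrable _ _
  · exact (h2.mul continuous_const).intervalIntegrable _ _

lemma dofTN_smul (r : ℝ) (τ : V2 → Mat2) (v : Fin 3 → V2) (i : Fin 3) :
    dofTN v i (r • τ) = r * dofTN v i τ := by
  rw [dofTN, dofTN, ← intervalIntegral.integral_const_mul]
  simp only [Pi.smul_apply, dot2_smul_mulVec, mul_assoc]

lemma isCompact_tri (v : Fin 3 → V2) : IsCompact (tri v) :=
  (Set.finite_range v).isCompact_convexHull ℝ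

lemma integrableOn_tri {f : V2 → ℝ} (hf : Continuous f) (v : Fin 3 → V2) :
    IntegrableOn f (tri v) :=
  hf.continuousOn.integrableOn_compact (isCompact_tri v)

lemma dofInt_add {τ σ : V2 → Mat2} (hτ : Continuous τ) (hσ : Continuous σ) (v : Fin 3 → V2)
    (q : Mat2) : dofInt v (τ + σ) q = dofInt v τ q + dofInt v σ q := by
  rw [dofInt, dofInt, dofInt, ← integral_add]
  · simp only [Pi.add_apply, Matrix.add_apply, add_mul, Finset.sum_add_distrib]
  · exact integrableOn_tri (by fun_prop) v
  · exact integrableOn_tri (by fun_prop) v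

lemma dofInt_smul (r : ℝ) (τ : V2 → Mat2) (v : Fin 3 → V2) (q : Mat2) :
    dofInt v (r • τ) q = r * dofInt v τ q := by
  rw [dofInt, dofInt, ← integral_const_mul]
  simp only [Pi.smul_apply, Matrix.smul_apply, smul_eq_mul, mul_assoc, Finset.mul_sum]

/-- Interior moments against symmetric matrices are combinations of three of them. -/
lemma dofInt_of_isSymm {τ : V2 → Mat2} (hτ : Continuous τ) (v : Fin 3 → V2)
    {q : Mat2} (hq : q.IsSymm) : dofInt v τ q = q 0 0 * dofInt v τ !![1,0;0,0] +
      q 1 1 * dofInt v τ !![0,0;0,1] + q 0 1 * dofInt v τ !![0,1;1,0] := by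
  have h10 : q 1 0 = q 0 1 := hq.apply 0 1
  have hc (q' : Mat2) : IntegrableOn (fun x => ∑ i, ∑ j, τ x i j * q' i j) (tri v) :=
    integrableOn_tri (by fun_prop) v
  simp only [dofInt]
  rw [← integral_const_mul, ← integral_const_mul, ← integral_const_mul, ← integral_add,
    ← integral_add]
  · congr 1 with x
    simp [Fin.sum_univ_two, h10]
    ring
  · exact ((hc _).const_mul _).add ((hc _).const_mul _)
  · exact (hc _).const_mul _
  · exact (hc _).const_mul _
  · exact (hc _).const_mul _

/-- The values of the 21 degrees of freedom. -/
abbrev DofSpace :=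
  (Fin 3 → Fin 3 → ℝ) × (Fin 3 → ℝ) × (Fin 3 → ℝ) × (Fin 3 → ℝ) × (Fin 3 → ℝ)

lemma finrank_dofSpace : Module.finrank ℝ DofSpace = 21 := by
  simp [DofSpace, Module.finrank_pi_fintype]

/-- The degrees of freedom of `fieldOf v w` as a linear map of `w`. -/
def dofMap (v : Fin 3 → V2) : (Fin 3 → Fin 10 → ℝ) →ₗ[ℝ] DofSpace where
  toFun w :=
    (fun i => ![fieldOf v w (v i) 0 0, fieldOf v w (v i) 0 1, fieldOf v w (v i) 1 1],
      fun i => dofNN v i (fieldOf v w) 1, fun i => dofNN v i (fieldOf v w) Polynomial.X,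
      fun i => dofTN v i (fieldOf v w),
      ![dofInt v (fieldOf v w) !![1,0;0,0], dofInt v (fieldOf v w) !![0,0;0,1],
        dofInt v (fieldOf v w) !![0,1;1,0]])
  map_add' w w' := by
    have h := continuous_fieldOf v
    simp only [map_add, dofNN_add (h w) (h w'), dofTN_add (h w) (h w'), dofInt_add (h w) (h w'),
      Pi.add_apply, Matrix.add_apply]
    refine Prod.ext ?_ (Prod.ext rfl (Prod.ext rfl (Prod.ext rfl ?_)))
    · ext i k
      fin_cases k <;> rfl
    · ext k
      fin_cases k <;> rfl
  map_smul' r w := by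
    simp only [map_smul, dofNN_smul, dofTN_smul, dofInt_smul, Pi.smul_apply, Matrix.smul_apply]
    refine Prod.ext ?_ (Prod.ext rfl (Prod.ext rfl (Prod.ext rfl ?_)))
    · ext i k
      fin_cases k <;> rfl
    · ext k
      fin_cases k <;> rfl

lemma dofMap_eq_iff (v : Fin 3 → V2) (w : Fin 3 → Fin 10 → ℝ) {A : Fin 3 → Mat2}
    (hA : ∀ i, (A i).IsSymm) (m₀ m₁ t₀ u : Fin 3 → ℝ) :
    dofMap v w = (fun i => ![A i 0 0, A i 0 1, A i 1 1], m₀, m₁, t₀, u) ↔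
      (∀ i, fieldOf v w (v i) = A i) ∧
      (∀ i, dofNN v i (fieldOf v w) 1 = m₀ i ∧ dofNN v i (fieldOf v w) Polynomial.X = m₁ i) ∧
      (∀ i, dofTN v i (fieldOf v w) = t₀ i) ∧
      dofInt v (fieldOf v w) !![1,0;0,0] = u 0 ∧ dofInt v (fieldOf v w) !![0,0;0,1] = u 1 ∧
      dofInt v (fieldOf v w) !![0,1;1,0] = u 2 := by
  have hvert (i : Fin 3) : fieldOf v w (v i) = A i ↔ fieldOf v w (v i) 0 0 = A i 0 0 ∧
      fieldOf v w (v i) 0 1 = A i 0 1 ∧ fieldOf v w (v i) 1 1 = A i 1 1 := by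
    refine ⟨fun h => by simp [h], fun ⟨h0, h1, h2⟩ => ?_⟩
    have h3 := (fieldOf_isSymm v w (v i)).apply 0 1
    have h4 := (hA i).apply 0 1
    ext k l
    fin_cases k <;> fin_cases l <;> simp <;> linarith
  simp only [hvert, dofMap, LinearMap.coe_mk, AddHom.coe_mk, Prod.mk.injEq, funext_iff,
    Fin.forall_fin_succ, IsEmpty.forall_iff]
  simp
  tauto

lemma integral_quartic (c₀ c₁ c₂ c₃ c₄ : ℝ) :
    ∫ s in (0:ℝ)..1, (c₀ + c₁ * s + c₂ * s ^ 2 + c₃ * s ^ 3 + c₄ * s ^ 4) =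
      c₀ + c₁ / 2 + c₂ / 3 + c₃ / 4 + c₄ / 5 := by
  have hI (f : ℝ → ℝ) (hf : Continuous f) : IntervalIntegrable f volume 0 1 :=
    hf.intervalIntegrable _ _
  rw [intervalIntegral.integral_add (hI _ (by fun_prop)) (hI _ (by fun_prop)),
    intervalIntegral.integral_add (hI _ (by fun_prop)) (hI _ (by fun_prop)),
    intervalIntegral.integral_add (hI _ (by fun_prop)) (hI _ (by fun_prop)),
    intervalIntegral.integral_add (hI _ (by fun_prop)) (hI _ (by fun_prop))]
  simp only [intervalIntegral.integral_const_mul, intervalIntegral.integral_const, integral_pow]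
  rw [intervalIntegral.integral_const_mul, integral_id]
  norm_num
  ring

lemma elen_ne_zero {v : Fin 3 → V2} (hv : AffineIndependent ℝ v) (i : Fin 3) : elen v i ≠ 0 := by
  intro h
  rw [elen, norm2, dot2,
    Real.sqrt_eq_zero (add_nonneg (mul_self_nonneg _) (mul_self_nonneg _))] at h
  have h0 : v (i + 2) 0 - v (i + 1) 0 = 0 := by
    simp only [Pi.sub_apply] at h
    nlinarith [sq_nonneg (v (i + 2) 0 - v (i + 1) 0), sq_nonneg (v (i + 2) 1 - v (i + 1) 1)]
  have h1 : v (i + 2) 1 - v (i + 1) 1 = 0 := by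
    simp only [Pi.sub_apply] at h
    nlinarith [sq_nonneg (v (i + 2) 0 - v (i + 1) 0), sq_nonneg (v (i + 2) 1 - v (i + 1) 1)]
  have : v (i + 2) = v (i + 1) := by
    ext j
    fin_cases j
    · exact sub_eq_zero.1 h0
    · exact sub_eq_zero.1 h1
  have := hv.injective this
  clear * - this
  fin_cases i <;> simp at this

lemma edgePt_zero (v : Fin 3 → V2) (i : Fin 3) : edgePt v i 0 = v (i + 1) := by
  simp [edgePt]

lemma edgePt_one (v : Fin 3 → V2) (i : Fin 3) : edgePt v i 1 = v (i + 2) := by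
  simp [edgePt]

/-- The edge degrees of freedom control the normal trace `τ n`. -/
lemma mulVec_nrml_eq_zero {v : Fin 3 → V2} (hv : AffineIndependent ℝ v) {τ : V2 → Mat2}
    (hτ : τ ∈ SigmaSet v) (hvert : ∀ i, τ (v i) = 0) (i : Fin 3) (h0 : dofNN v i τ 1 = 0)
    (h1 : dofNN v i τ Polynomial.X = 0) (ht : dofTN v i τ = 0) (r : ℝ) :
    (τ (edgePt v i r)).mulVec (nrml v i) = 0 := by
  have hL := elen_ne_zero hv i
  have htan : dot2 (tang v i) ((τ (edgePt v i r)).mulVec (nrml v i)) = 0 := by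
    obtain ⟨c₀, c₁, c₂, c₃, hc⟩ := hτ.1.exists_cubic_edge v i (tang v i) (nrml v i)
    have e3 := (isPoly1_two_iff hc).1 (hτ.2.2.2 i)
    have e0 := hc 0
    have e1 := hc 1
    rw [edgePt_zero, hvert] at e0
    rw [edgePt_one, hvert] at e1
    simp only [dot2_mulVec, Matrix.zero_apply] at e0 e1
    rw [hc 3, hc 2, hc 1, hc 0] at e3
    simp only [dofTN, intervalIntegral.integral_mul_const, hc] at ht
    have e2 := integral_quartic c₀ c₁ c₂ c₃ 0
    simp only [zero_mul, add_zero] at e2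
    rw [e2] at ht
    replace ht := (mul_eq_zero.1 ht).resolve_right hL
    obtain rfl : c₀ = 0 := by linarith
    obtain rfl : c₃ = 0 := by linarith
    obtain rfl : c₂ = 0 := by linarith
    obtain rfl : c₁ = 0 := by linarith
    rw [hc]
    ring
  have hnor : dot2 (nrml v i) ((τ (edgePt v i r)).mulVec (nrml v i)) = 0 := by
    obtain ⟨c₀, c₁, c₂, c₃, hc⟩ := hτ.1.exists_cubic_edge v i (nrml v i) (nrml v i)
    have e0 := hc 0
    have e1 := hc 1
    rw [edgePt_zero, hvert] at e0
    rw [edgePt_one, hvert] at e1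
    simp only [dot2_mulVec, Matrix.zero_apply] at e0 e1
    simp only [dofNN, intervalIntegral.integral_mul_const, hc, Polynomial.eval_one,
      Polynomial.eval_X, mul_one] at h0 h1
    have e2 := integral_quartic c₀ c₁ c₂ c₃ 0
    simp only [zero_mul, add_zero] at e2
    have e3 := integral_quartic 0 c₀ c₁ c₂ c₃
    rw [show (fun s : ℝ => (0:ℝ) + c₀ * s + c₁ * s ^ 2 + c₂ * s ^ 3 + c₃ * s ^ 4) =
      fun s => (c₀ + c₁ * s + c₂ * s ^ 2 + c₃ * s ^ 3) * s by ext s; ring] at e3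
    rw [e2] at h0
    rw [e3] at h1
    replace h0 := (mul_eq_zero.1 h0).resolve_right hL
    replace h1 := (mul_eq_zero.1 h1).resolve_right hL
    obtain rfl : c₀ = 0 := by linarith
    obtain rfl : c₃ = 0 := by linarith
    obtain rfl : c₂ = 0 := by linarith
    obtain rfl : c₁ = 0 := by linarith
    rw [hc]
    ring
  have htt : tang v i 0 ^ 2 + tang v i 1 ^ 2 ≠ 0 := by
    intro h
    have t0 : tang v i 0 = 0 := by nlinarith [sq_nonneg (tang v i 0), sq_nonneg (tang v i 1)]
    have t1 : tang v i 1 = 0 := by nlinarith [sq_nonneg (tang v i 0), sq_nonneg (tang v i 1)]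
    simp only [tang, Pi.smul_apply, smul_eq_mul, mul_eq_zero, inv_eq_zero, hL, false_or] at t0 t1
    refine hL ?_
    rw [elen, norm2, dot2, t0, t1]
    simp
  generalize (τ (edgePt v i r)).mulVec (nrml v i) = y at *
  simp only [dot2, nrml, rot, Matrix.cons_val] at htan hnor
  ext k
  refine (mul_eq_zero.1 ?_).resolve_left htt
  fin_cases k <;> simp only [Fin.zero_eta, Fin.mk_one]
  · linear_combination tang v i 0 * htan + tang v i 1 * hnor
  · linear_combination tang v i 1 * htan - tang v i 0 * hnor

/-- Vanishing of the normal trace, expressed in the basis of edge vectors at `v 0`. -/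
lemma baryCubic_of_mulVec_nrml {v : Fin 3 → V2} (hv : AffineIndependent ℝ v)
    (w : Fin 3 → Fin 10 → ℝ) (i : Fin 3) (x : V2) (h : (fieldOf v w x).mulVec (nrml v i) = 0) :
    baryCubic v (w 0) x * cross2 (v 1 - v 0) (v (i + 2) - v (i + 1)) +
      baryCubic v (w 1) x * cross2 (v 2 - v 0) (v (i + 2) - v (i + 1)) = 0 ∧
    baryCubic v (w 1) x * cross2 (v 1 - v 0) (v (i + 2) - v (i + 1)) +
      baryCubic v (w 2) x * cross2 (v 2 - v 0) (v (i + 2) - v (i + 1)) = 0 := by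
  refine eq_zero_of_edge_comb (area2_ne_zero hv) fun k => ?_
  have hk := congrFun h k
  refine (mul_eq_zero.1 ?_).resolve_left (inv_ne_zero (elen_ne_zero hv i))
  rw [Matrix.mulVec, dotProduct, Fin.sum_univ_two] at hk
  simp only [fieldOf_apply, nrml, rot, tang, Matrix.cons_val, Pi.smul_apply, smul_eq_mul,
    Pi.zero_apply] at hk
  rw [← hk]
  simp only [cross2, Pi.sub_apply]
  ring

lemma edgePt_eq_zero (v : Fin 3 → V2) (r : ℝ) :
    edgePt v 0 r = v 0 + (1 - r) • (v 1 - v 0) + r • (v 2 - v 0) := by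
  ext k
  simp [edgePt]
  ring

lemma edgePt_eq_one (v : Fin 3 → V2) (r : ℝ) :
    edgePt v 1 r = v 0 + (0 : ℝ) • (v 1 - v 0) + (1 - r) • (v 2 - v 0) := by
  ext k
  simp [edgePt]
  ring

lemma edgePt_eq_two (v : Fin 3 → V2) (r : ℝ) :
    edgePt v 2 r = v 0 + r • (v 1 - v 0) + (0 : ℝ) • (v 2 - v 0) := by
  ext k
  simp [edgePt]

lemma baryCubic_comb {v : Fin 3 → V2} (hD : area2 v ≠ 0) (c : Fin 10 → ℝ) (m n : ℝ) :
    baryCubic v c (v 0 + m • (v 1 - v 0) + n • (v 2 - v 0)) = cubic c m n := by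
  rw [baryCubic, bary1_comb hD, bary2_comb hD]

lemma cubic_left_edge {c : Fin 10 → ℝ} (h : ∀ r, cubic c 0 (1 - r) = 0) :
    c 0 = 0 ∧ c 2 = 0 ∧ c 5 = 0 ∧ c 9 = 0 := by
  have h0 := h 0
  have h1 := h 1
  have h2 := h 2
  have h3 := h 3
  simp only [cubic] at h0 h1 h2 h3
  refine ⟨?_, ?_, ?_, ?_⟩ <;> linarith

lemma cubic_bottom_edge {c : Fin 10 → ℝ} (h : ∀ r, cubic c r 0 = 0) :
    c 0 = 0 ∧ c 1 = 0 ∧ c 3 = 0 ∧ c 6 = 0 := by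
  have h0 := h 0
  have h1 := h 1
  have h2 := h 2
  have h3 := h 3
  simp only [cubic] at h0 h1 h2 h3
  refine ⟨?_, ?_, ?_, ?_⟩ <;> linarith

/-- A field with affine divergence and vanishing normal trace is a combination of three
quadratic bubbles. -/
lemma bubble_of_mulVec_nrml {v : Fin 3 → V2} (hv : AffineIndependent ℝ v)
    {w : Fin 3 → Fin 10 → ℝ} (hdiv : divCoeff w = 0)
    (h : ∀ i r, (fieldOf v w (edgePt v i r)).mulVec (nrml v i) = 0) :
    ∃ α β γ : ℝ, ∀ s t, cubic (w 1) s t = γ * (s * t) ∧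
      cubic (w 0) s t = α * (s * (1 - s - t)) - γ * (s * t) ∧
      cubic (w 2) s t = β * (t * (1 - s - t)) - γ * (s * t) := by
  have hD := area2_ne_zero hv
  have H (i : Fin 3) (r : ℝ) := baryCubic_of_mulVec_nrml hv w i _ (h i r)
  have H0 (r : ℝ) : cubic (w 0) (1 - r) r + cubic (w 1) (1 - r) r = 0 ∧
      cubic (w 1) (1 - r) r + cubic (w 2) (1 - r) r = 0 := by
    have := H 0 r
    rw [edgePt_eq_zero] at this
    simp only [baryCubic_comb hD] at this
    have ha : cross2 (v 1 - v 0) (v (0 + 2) - v (0 + 1)) = area2 v := by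
      simp [cross2, area2]; ring
    have hb : cross2 (v 2 - v 0) (v (0 + 2) - v (0 + 1)) = area2 v := by
      simp [cross2, area2]; ring
    rw [ha, hb, ← add_mul, ← add_mul] at this
    simpa [hD] using this
  have H1 (r : ℝ) : cubic (w 0) 0 (1 - r) = 0 ∧ cubic (w 1) 0 (1 - r) = 0 := by
    have := H 1 r
    rw [edgePt_eq_one] at this
    simp only [baryCubic_comb hD] at this
    have ha : cross2 (v 1 - v 0) (v (1 + 2) - v (1 + 1)) = -area2 v := by
      simp [cross2, area2]; ring
    have hb : cross2 (v 2 - v 0) (v (1 + 2) - v (1 + 1)) = 0 := by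
      simp [cross2]; ring
    rw [ha, hb] at this
    simpa [hD] using this
  have H2 (r : ℝ) : cubic (w 1) r 0 = 0 ∧ cubic (w 2) r 0 = 0 := by
    have := H 2 r
    rw [edgePt_eq_two] at this
    simp only [baryCubic_comb hD] at this
    have ha : cross2 (v 1 - v 0) (v (2 + 2) - v (2 + 1)) = 0 := by
      simp [cross2]; ring
    have hb : cross2 (v 2 - v 0) (v (2 + 2) - v (2 + 1)) = -area2 v := by
      simp [cross2, area2]; ring
    rw [ha, hb] at this
    simpa [hD] using this
  obtain ⟨p0, p2, p5, p9⟩ := cubic_left_edge fun r => (H1 r).1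
  obtain ⟨q0, q2, q5, q9⟩ := cubic_left_edge fun r => (H1 r).2
  obtain ⟨-, q1, q3, q6⟩ := cubic_bottom_edge fun r => (H2 r).1
  obtain ⟨r0, r1, r3, r6⟩ := cubic_bottom_edge fun r => (H2 r).2
  obtain ⟨d1, d2, d3, d4, d5, d6⟩ := (divCoeff_eq_zero_iff w).1 hdiv
  have a0 := H0 0
  have a1 := H0 (-1)
  have a2 := H0 2
  have a3 := H0 3
  have a4 := H0 1
  simp only [cubic, p0, p2, p5, p9, q0, q2, q5, q9, q1, q3, q6, r0, r1, r3, r6] at a0 a1 a2 a3 a4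
  have q7 : w 1 7 = 0 := by linarith
  have q8 : w 1 8 = 0 := by linarith
  refine ⟨w 0 1, w 2 2, w 1 4, fun s t => ?_⟩
  have p6 : w 0 6 = 0 := by linarith
  have p7 : w 0 7 = 0 := by linarith
  have p8 : w 0 8 = 0 := by linarith
  have p3 : w 0 3 = - w 0 1 := by linarith
  have p4 : w 0 4 = - w 0 1 - w 1 4 := by linarith
  have r7 : w 2 7 = 0 := by linarith
  have r8 : w 2 8 = 0 := by linarith
  have r9 : w 2 9 = 0 := by linarith
  have r5 : w 2 5 = - w 2 2 := by linarith
  have r4 : w 2 4 = - w 2 2 - w 1 4 := by linarith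
  simp only [cubic, p0, p2, p5, p9, q0, q2, q5, q9, q1, q3, q6, r0, r1, r3, r6, q7, q8, p6, p7, p8,
    p3, p4, r7, r8, r9, r5, r4]
  refine ⟨?_, ?_, ?_⟩ <;> ring

lemma tri_subset {v : Fin 3 → V2} (hD : area2 v ≠ 0) {x : V2} (hx : x ∈ tri v) :
    0 ≤ bary1 v x ∧ 0 ≤ bary2 v x ∧ bary1 v x + bary2 v x ≤ 1 := by
  have hconv : Convex ℝ {x | 0 ≤ bary1 v x ∧ 0 ≤ bary2 v x ∧ bary1 v x + bary2 v x ≤ 1} := by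
    intro x hx y hy a b ha hb hab
    have e1 : bary1 v (a • x + b • y) = a * bary1 v x + b * bary1 v y := by
      obtain rfl : a = 1 - b := by linarith
      simp [bary1, cross2]
      ring
    have e2 : bary2 v (a • x + b • y) = a * bary2 v x + b * bary2 v y := by
      obtain rfl : a = 1 - b := by linarith
      simp [bary2, cross2]
      ring
    obtain ⟨x1, x2, x3⟩ := hx
    obtain ⟨y1, y2, y3⟩ := hy
    simp only [Set.mem_ofPred_eq, e1, e2]
    refine ⟨by positivity, by positivity, ?_⟩
    nlinarith [mul_le_mul_of_nonneg_left x3 ha, mul_le_mul_of_nonneg_left y3 hb]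
  refine convexHull_min ?_ hconv hx
  rintro _ ⟨i, rfl⟩
  have h0 := bary1_comb hD 0 0
  have h0' := bary2_comb hD 0 0
  have h1 := bary1_comb hD 1 0
  have h1' := bary2_comb hD 1 0
  have h2 := bary1_comb hD 0 1
  have h2' := bary2_comb hD 0 1
  simp only [zero_smul, one_smul, add_zero, add_sub_cancel] at h0 h0' h1 h1' h2 h2'
  fin_cases i
  · simp [h0, h0']
  · simp [h1, h1']
  · simp [h2, h2']

lemma mem_tri_of_bary {v : Fin 3 → V2} (hD : area2 v ≠ 0) {x : V2} (h1 : 0 ≤ bary1 v x)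
    (h2 : 0 ≤ bary2 v x) (h3 : bary1 v x + bary2 v x ≤ 1) : x ∈ tri v := by
  have hmem := (convex_convexHull ℝ (Set.range v)).sum_mem (t := Finset.univ)
    (w := ![1 - bary1 v x - bary2 v x, bary1 v x, bary2 v x]) (z := v)
    (by
      intro i _
      fin_cases i <;> simp <;> linarith)
    (by
      simp [Fin.sum_univ_three]
      ring)
    (fun i _ => subset_convexHull ℝ _ ⟨i, rfl⟩)
  have e : ∑ i, (![1 - bary1 v x - bary2 v x, bary1 v x, bary2 v x] : Fin 3 → ℝ) i • v i = x := by
    conv_rhs => rw [eq_bary_comb hD x]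
    simp only [Fin.sum_univ_three, Matrix.cons_val]
    module
  rwa [e] at hmem

/-- A continuous function that is nonnegative on the triangle and positive in its interior has
positive integral. -/
lemma integral_tri_pos {v : Fin 3 → V2} (hD : area2 v ≠ 0) {f : V2 → ℝ} (hf : Continuous f)
    (h0 : ∀ x, 0 ≤ bary1 v x → 0 ≤ bary2 v x → bary1 v x + bary2 v x ≤ 1 → 0 ≤ f x)
    (hpos : ∀ x, 0 < bary1 v x → 0 < bary2 v x → bary1 v x + bary2 v x < 1 → 0 < f x) :
    0 < ∫ x in tri v, f x := by
  have hmeas : MeasurableSet (tri v) := (isCompact_tri v).measurableSet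
  rw [setIntegral_pos_iff_support_of_nonneg_ae _ (integrableOn_tri hf v)]
  · have hc1 := (polyDeg_bary1 v).continuous
    have hc2 := (polyDeg_bary2 v).continuous
    have hopen : IsOpen {x | 0 < bary1 v x ∧ 0 < bary2 v x ∧ bary1 v x + bary2 v x < 1} :=
      (isOpen_lt continuous_const hc1).inter
        ((isOpen_lt continuous_const hc2).inter (isOpen_lt (hc1.add hc2) continuous_const))
    refine (hopen.measure_pos volume ⟨v 0 + (1 / 3 : ℝ) • (v 1 - v 0) +
      (1 / 3 : ℝ) • (v 2 - v 0), ?_⟩).trans_le (measure_mono ?_)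
    · simp only [Set.mem_ofPred_eq, bary1_comb hD, bary2_comb hD]
      norm_num
    · rintro x ⟨h1, h2, h3⟩
      exact ⟨(hpos x h1 h2 h3).ne', mem_tri_of_bary hD h1.le h2.le h3.le⟩
  · filter_upwards [ae_restrict_mem hmeas] with x hx
    obtain ⟨h1, h2, h3⟩ := tri_subset hD hx
    exact h0 x h1 h2 h3

/-- The interior moments control the means of the three components of `fieldOf v w`. -/
lemma integral_baryCubic_eq_zero {v : Fin 3 → V2} (hD : area2 v ≠ 0) {w : Fin 3 → Fin 10 → ℝ}
    (h : ∀ q : Mat2, q.IsSymm → dofInt v (fieldOf v w) q = 0) (k : Fin 3) :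
    ∫ x in tri v, baryCubic v (w k) x = 0 := by
  have key (q : Mat2) (hq : q.IsSymm) (r : ℝ) (hr : r ≠ 0)
      (he : ∀ x, ∑ i, ∑ j, fieldOf v w x i j * q i j = r * baryCubic v (w k) x) :
      ∫ x in tri v, baryCubic v (w k) x = 0 := by
    have := h q hq
    simp only [dofInt, he, integral_const_mul] at this
    exact (mul_eq_zero.1 this).resolve_left hr
  set a := v 1 - v 0 with ha
  set b := v 2 - v 0 with hb
  have hab : area2 v = a 0 * b 1 - a 1 * b 0 := rfl
  have hsymm (p q r : ℝ) : (!![p, q; q, r] : Mat2).IsSymm := by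
    ext i j
    fin_cases i <;> fin_cases j <;> rfl
  fin_cases k
  · refine key !![b 1 ^ 2, -(b 0 * b 1); -(b 0 * b 1), b 0 ^ 2] (hsymm _ _ _) (area2 v ^ 2)
      (pow_ne_zero 2 hD) fun x => ?_
    simp [Fin.sum_univ_two, fieldOf_apply, hab, ha, hb]
    ring
  · refine key !![2 * (a 1 * b 1), -(a 0 * b 1 + a 1 * b 0); -(a 0 * b 1 + a 1 * b 0),
      2 * (a 0 * b 0)] (hsymm _ _ _) (-2 * area2 v ^ 2)
      (mul_ne_zero (by norm_num) (pow_ne_zero 2 hD)) fun x => ?_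
    simp [Fin.sum_univ_two, fieldOf_apply, hab, ha, hb]
    ring
  · refine key !![a 1 ^ 2, -(a 0 * a 1); -(a 0 * a 1), a 0 ^ 2] (hsymm _ _ _) (area2 v ^ 2)
      (pow_ne_zero 2 hD) fun x => ?_
    simp [Fin.sum_univ_two, fieldOf_apply, hab, ha, hb]
    ring

/-- A field in `SigmaSet v` all of whose degrees of freedom vanish is zero. -/
lemma eq_zero_of_dofs_eq_zero {v : Fin 3 → V2} (hv : AffineIndependent ℝ v) {τ : V2 → Mat2}
    (hτ : τ ∈ SigmaSet v) (hvert : ∀ i, τ (v i) = 0)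
    (hNN : ∀ i, dofNN v i τ 1 = 0 ∧ dofNN v i τ Polynomial.X = 0)
    (hTN : ∀ i, dofTN v i τ = 0) (hInt : ∀ q : Mat2, q.IsSymm → dofInt v τ q = 0) : τ = 0 := by
  have hD := area2_ne_zero hv
  obtain ⟨w, rfl⟩ := exists_fieldOf hD hτ.1 hτ.2.1
  obtain ⟨α, β, γ, hc⟩ := bubble_of_mulVec_nrml hv ((isPolyVec_divMat_iff hD w).1 hτ.2.2.1)
    fun i => mulVec_nrml_eq_zero hv hτ hvert i (hNN i).1 (hNN i).2 (hTN i)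
  have hI := integral_baryCubic_eq_zero hD hInt
  have hc1 := (polyDeg_bary1 v).continuous
  have hc2 := (polyDeg_bary2 v).continuous
  have hγ : γ = 0 := by
    have h := hI 1
    simp only [baryCubic, fun s t => (hc s t).1, integral_const_mul] at h
    exact (mul_eq_zero.1 h).resolve_right (integral_tri_pos hD (hc1.mul hc2)
      (fun x h1 h2 _ => mul_nonneg h1 h2) fun x h1 h2 _ => mul_pos h1 h2).ne'
  subst hγ
  have hα : α = 0 := by
    have h := hI 0
    simp only [baryCubic, fun s t => (hc s t).2.1, zero_mul, sub_zero, integral_const_mul] at h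
    exact (mul_eq_zero.1 h).resolve_right (integral_tri_pos hD (by fun_prop)
      (fun x h1 _ h3 => mul_nonneg h1 (by linarith)) fun x h1 _ h3 =>
        mul_pos h1 (by linarith)).ne'
  have hβ : β = 0 := by
    have h := hI 2
    simp only [baryCubic, fun s t => (hc s t).2.2, zero_mul, sub_zero, integral_const_mul] at h
    exact (mul_eq_zero.1 h).resolve_right (integral_tri_pos hD (by fun_prop)
      (fun x _ h2 h3 => mul_nonneg h2 (by linarith)) fun x _ h2 h3 =>
        mul_pos h2 (by linarith)).ne'
  subst hα hβ
  ext x i j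
  simp [fieldOf_apply, baryCubic, hc]

/-- The field `fieldOf v w` determines `w`. -/
lemma fieldOf_eq_zero {v : Fin 3 → V2} (hD : area2 v ≠ 0) {w : Fin 3 → Fin 10 → ℝ}
    (h : fieldOf v w = 0) : w = 0 := by
  have hint (k : Fin 3) (x : V2) : baryCubic v (w k) x = 0 := by
    have hx (i j : Fin 2) : fieldOf v w x i j = 0 := by simp [h]
    simp only [fieldOf_apply] at hx
    have h' (j : Fin 2) := eq_zero_of_edge_comb hD
      (X := baryCubic v (w 0) x * (v 1 j - v 0 j) + baryCubic v (w 1) x * (v 2 j - v 0 j))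
      (Y := baryCubic v (w 1) x * (v 1 j - v 0 j) + baryCubic v (w 2) x * (v 2 j - v 0 j))
      fun i => by linarith [hx i j]
    obtain ⟨e0, e1⟩ := eq_zero_of_edge_comb hD (X := baryCubic v (w 0) x)
      (Y := baryCubic v (w 1) x) fun j => by linarith [(h' j).1]
    obtain ⟨-, e2⟩ := eq_zero_of_edge_comb hD (X := baryCubic v (w 1) x)
      (Y := baryCubic v (w 2) x) fun j => by linarith [(h' j).2]
    fin_cases k
    exacts [e0, e1, e2]
  ext k n
  have hk (s t : ℝ) : cubic (w k) s t = 0 := by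
    rw [← baryCubic_comb hD]
    exact hint k _
  obtain ⟨c0, c2, c5, c9⟩ := cubic_left_edge fun r => hk 0 (1 - r)
  obtain ⟨-, c1, c3, c6⟩ := cubic_bottom_edge fun r => hk r 0
  have h11 := hk 1 1
  have h12 := hk 1 (-1)
  have h21 := hk 2 1
  simp only [cubic, c0, c2, c5, c9, c1, c3, c6] at h11 h12 h21
  have c4 : w k 4 = 0 := by linarith
  have c7 : w k 7 = 0 := by linarith
  have c8 : w k 8 = 0 := by linarith
  fin_cases n
  exacts [c0, c1, c2, c3, c4, c5, c6, c7, c8, c9]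

lemma dofMap_injective {v : Fin 3 → V2} (hv : AffineIndependent ℝ v) :
    Function.Injective ((dofMap v).domRestrict (sigmaCoeff v)) := by
  have hD := area2_ne_zero hv
  rw [injective_iff_map_eq_zero]
  rintro ⟨w, hw⟩ h
  have h0 : dofMap v w = (fun i => ![(0 : Fin 3 → Mat2) i 0 0, (0 : Fin 3 → Mat2) i 0 1,
      (0 : Fin 3 → Mat2) i 1 1], 0, 0, 0, 0) := by
    rw [show dofMap v w = 0 from h]
    refine Prod.ext ?_ rfl
    ext i k
    fin_cases k <;> rfl
  obtain ⟨h1, h2, h3, h4, h5, h6⟩ :=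
    (dofMap_eq_iff v w (fun i => Matrix.isSymm_zero) 0 0 0 0).1 h0
  refine Subtype.ext (fieldOf_eq_zero hD (eq_zero_of_dofs_eq_zero hv
    ((fieldOf_mem_iff hD w).2 hw) h1 h2 h3 fun q hq => ?_))
  rw [dofInt_of_isSymm (continuous_fieldOf v w) v hq, h4, h5, h6]
  simp

lemma finrank_sigmaCoeff {v : Fin 3 → V2} (hv : AffineIndependent ℝ v) :
    Module.finrank ℝ (sigmaCoeff v) = 21 := by
  refine le_antisymm ?_ (finrank_sigmaCoeff_ge v)
  rw [← finrank_dofSpace]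
  exact LinearMap.finrank_le_finrank_of_injective (dofMap_injective hv)

lemma dofMap_surjective {v : Fin 3 → V2} (hv : AffineIndependent ℝ v) :
    Function.Surjective ((dofMap v).domRestrict (sigmaCoeff v)) :=
  (LinearMap.injective_iff_surjective_of_finrank_eq_finrank
    ((finrank_sigmaCoeff hv).trans finrank_dofSpace.symm)).1 (dofMap_injective hv)

/-- dim Σ(K) = 21 and the 21 DoFs (vertex values, edge normal-normal
moments against ℙ₁(e), edge tangent-normal means, interior moments against constant
symmetric matrices) are unisolvent on Σ(K); in particular if all DoFs vanish at
τ ∈ Σ(K) then τ = 0. -/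
theorem statement1 (v : Fin 3 → V2) (hv : AffineIndependent ℝ v) :
    -- dim Σ(K) = 21
    (∃ b : Fin 21 → (V2 → Mat2), (∀ m, b m ∈ SigmaSet v) ∧ LinearIndependent ℝ b ∧
      ∀ τ ∈ SigmaSet v, ∃ c : Fin 21 → ℝ, τ = ∑ m, c m • b m) ∧
    -- unisolvence: any prescribed 21 DoF values are attained by a unique τ ∈ Σ(K)
    (∀ (Aval : Fin 3 → Mat2), (∀ i, (Aval i).IsSymm) →
      ∀ (m₀ m₁ t₀ w : Fin 3 → ℝ),
      ∃! τ : V2 → Mat2, τ ∈ SigmaSet v ∧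
        (∀ i, τ (v i) = Aval i) ∧
        (∀ i, dofNN v i τ 1 = m₀ i ∧ dofNN v i τ Polynomial.X = m₁ i) ∧
        (∀ i, dofTN v i τ = t₀ i) ∧
        dofInt v τ !![1,0;0,0] = w 0 ∧ dofInt v τ !![0,0;0,1] = w 1 ∧
        dofInt v τ !![0,1;1,0] = w 2) ∧
    -- in particular: vanishing of all the DoFs implies τ = 0
    (∀ τ ∈ SigmaSet v,
      (∀ i, τ (v i) = 0) →
      (∀ i, ∀ P : Polynomial ℝ, P.natDegree ≤ 1 → dofNN v i τ P = 0) →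
      (∀ i, dofTN v i τ = 0) →
      (∀ q : Mat2, q.IsSymm → dofInt v τ q = 0) →
      τ = 0) := by
  have hD := area2_ne_zero hv
  refine ⟨?_, ?_, ?_⟩
  · let b := Module.finBasisOfFinrankEq ℝ (sigmaCoeff v) (finrank_sigmaCoeff hv)
    let Φ := (fieldOf v).domRestrict (sigmaCoeff v)
    refine ⟨fun m => Φ (b m), fun m => (fieldOf_mem_iff hD _).2 (b m).2, ?_, fun τ hτ => ?_⟩
    · refine b.linearIndependent.map' Φ (LinearMap.ker_eq_bot'.2 fun w hw => ?_)
      exact Subtype.ext (fieldOf_eq_zero hD hw)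
    · obtain ⟨w, hw, rfl⟩ := exists_sigmaCoeff hD hτ
      refine ⟨b.repr ⟨w, hw⟩, ?_⟩
      have h := congrArg Φ (b.sum_repr ⟨w, hw⟩)
      rw [map_sum] at h
      simp only [map_smul] at h
      exact h.symm
  · intro A hA m₀ m₁ t₀ u
    obtain ⟨⟨w, hw⟩, hdof⟩ := dofMap_surjective hv
      (fun i => ![A i 0 0, A i 0 1, A i 1 1], m₀, m₁, t₀, u)
    refine ⟨fieldOf v w, ⟨(fieldOf_mem_iff hD w).2 hw, (dofMap_eq_iff v w hA m₀ m₁ t₀ u).1 hdof⟩,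
      ?_⟩
    rintro _ ⟨hσ, hσdof⟩
    obtain ⟨w', hw', rfl⟩ := exists_sigmaCoeff hD hσ
    have h := (dofMap_eq_iff v w' hA m₀ m₁ t₀ u).2 hσdof
    exact congrArg (fun z => fieldOf v z)
      (congrArg Subtype.val (@dofMap_injective v hv ⟨w', hw'⟩ ⟨w, hw⟩ (h.trans hdof.symm)))
  · intro τ hτ hvert hNN hTN hInt
    exact eq_zero_of_dofs_eq_zero hv hτ hvert
      (fun i => ⟨hNN i 1 (by simp), hNN i Polynomial.X (by simp)⟩) hTN hInt
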